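/- The unit normals of a patch and of its inverse patch satisfy U_y = −U_x + (2η/‖x − c‖²)(x − c) at every point (u,v). -/

import Mathlib

noncomputable section
open scoped RealInnerProductSpace

/-- ℝ³ as Euclidean 3-space. -/
abbrev E3 : Type := EuclideanSpace ℝ (Fin 3)

/-- The cross product on ℝ³. -/
def cross (a b : E3) : E3 :=
  (WithLp.equiv 2 (Fin 3 → ℝ)).symm
    ![a 1 * b 2 - a 2 * b 1, a 2 * b 0 - a 0 * b 2, a 0 * b 1 - a 1 * b 0]

/-- The inversion of ℝ³ with center `c` and radius `r`. -/
def inv3 (c : E3) (r : ℝ) (p : E3) : E3 :=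
  c + (r ^ 2 / ‖p - c‖ ^ 2) • (p - c)

/-- Partial derivative in the first variable. -/
def pu {E : Type*} [NormedAddCommGroup E] [NormedSpace ℝ E]
    (x : ℝ → ℝ → E) (u v : ℝ) : E :=
  deriv (fun t => x t v) u

/-- Partial derivative in the second variable. -/
def pv {E : Type*} [NormedAddCommGroup E] [NormedSpace ℝ E]
    (x : ℝ → ℝ → E) (u v : ℝ) : E :=
  deriv (fun t => x u t) v

/-- The unit normal of a patch. -/
def unormal (x : ℝ → ℝ → E3) (u v : ℝ) : E3 :=
  ‖cross (pu x u v) (pv x u v)‖⁻¹ • cross (pu x u v) (pv x u v)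

/-- The conformal factor λ of the inversion along the patch. -/
def lam (c : E3) (r : ℝ) (x : ℝ → ℝ → E3) (u v : ℝ) : ℝ :=
  r ^ 2 / ‖x u v - c‖ ^ 2

/-- The support-type function η = ⟨U_x, x − c⟩. -/
def eta (c : E3) (x : ℝ → ℝ → E3) (u v : ℝ) : ℝ :=
  ⟪unormal x u v, x u v - c⟫

/-- First fundamental form coefficient E. -/
def FFE (x : ℝ → ℝ → E3) (u v : ℝ) : ℝ := ⟪pu x u v, pu x u v⟫
/-- First fundamental form coefficient F. -/
def FFF (x : ℝ → ℝ → E3) (u v : ℝ) : ℝ := ⟪pu x u v, pv x u v⟫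
/-- First fundamental form coefficient G. -/
def FFG (x : ℝ → ℝ → E3) (u v : ℝ) : ℝ := ⟪pv x u v, pv x u v⟫
/-- Second fundamental form coefficient e. -/
def SFe (x : ℝ → ℝ → E3) (u v : ℝ) : ℝ := ⟪pu (pu x) u v, unormal x u v⟫
/-- Second fundamental form coefficient f. -/
def SFf (x : ℝ → ℝ → E3) (u v : ℝ) : ℝ := ⟪pv (pu x) u v, unormal x u v⟫
/-- Second fundamental form coefficient g. -/
def SFg (x : ℝ → ℝ → E3) (u v : ℝ) : ℝ := ⟪pv (pv x) u v, unormal x u v⟫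
/-- Third fundamental form coefficient P. -/
def TFP (x : ℝ → ℝ → E3) (u v : ℝ) : ℝ := ⟪pu (unormal x) u v, pu (unormal x) u v⟫
/-- Third fundamental form coefficient Q. -/
def TFQ (x : ℝ → ℝ → E3) (u v : ℝ) : ℝ := ⟪pu (unormal x) u v, pv (unormal x) u v⟫
/-- Third fundamental form coefficient R. -/
def TFR (x : ℝ → ℝ → E3) (u v : ℝ) : ℝ := ⟪pv (unormal x) u v, pv (unormal x) u v⟫

/-- Christoffel symbol Γ¹₁₁. -/
def Ch111 (x : ℝ → ℝ → E3) (u v : ℝ) : ℝ :=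
  (FFG x u v * pu (FFE x) u v - 2 * FFF x u v * pu (FFF x) u v + FFF x u v * pv (FFE x) u v) /
    (2 * (FFE x u v * FFG x u v - FFF x u v ^ 2))
/-- Christoffel symbol Γ²₁₁. -/
def Ch211 (x : ℝ → ℝ → E3) (u v : ℝ) : ℝ :=
  (2 * FFE x u v * pu (FFF x) u v - FFE x u v * pv (FFE x) u v - FFF x u v * pu (FFE x) u v) /
    (2 * (FFE x u v * FFG x u v - FFF x u v ^ 2))
/-- Christoffel symbol Γ¹₁₂. -/
def Ch112 (x : ℝ → ℝ → E3) (u v : ℝ) : ℝ :=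
  (FFG x u v * pv (FFE x) u v - FFF x u v * pu (FFG x) u v) /
    (2 * (FFE x u v * FFG x u v - FFF x u v ^ 2))
/-- Christoffel symbol Γ²₁₂. -/
def Ch212 (x : ℝ → ℝ → E3) (u v : ℝ) : ℝ :=
  (FFE x u v * pu (FFG x) u v - FFF x u v * pv (FFE x) u v) /
    (2 * (FFE x u v * FFG x u v - FFF x u v ^ 2))
/-- Christoffel symbol Γ¹₂₂. -/
def Ch122 (x : ℝ → ℝ → E3) (u v : ℝ) : ℝ :=
  (2 * FFG x u v * pv (FFF x) u v - FFG x u v * pu (FFG x) u v - FFF x u v * pv (FFG x) u v) /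
    (2 * (FFE x u v * FFG x u v - FFF x u v ^ 2))
/-- Christoffel symbol Γ²₂₂. -/
def Ch222 (x : ℝ → ℝ → E3) (u v : ℝ) : ℝ :=
  (FFE x u v * pv (FFG x) u v - 2 * FFF x u v * pv (FFF x) u v + FFF x u v * pu (FFG x) u v) /
    (2 * (FFE x u v * FFG x u v - FFF x u v ^ 2))

/-- The tangent map of the inversion at `p`. -/
def phiStar (c : E3) (r : ℝ) (p : E3) (w : E3) : E3 :=
  (r ^ 2 / ‖p - c‖ ^ 2) • w - (2 * r ^ 2 * ⟪p - c, w⟫ / ‖p - c‖ ^ 4) • (p - c)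

theorem cross_smul_smul (s : ℝ) (a b : E3) : cross (s • a) (s • b) = s ^ 2 • cross a b := by
  ext i
  fin_cases i <;> simp [cross] <;> ring

theorem reflection_orthogonal_singleton_apply (q w : E3) :
    (ℝ ∙ q)ᗮ.reflection w = w - (2 * ⟪q, w⟫ / ‖q‖ ^ 2) • q := by
  rw [Submodule.reflection_orthogonal_apply, Submodule.reflection_singleton_apply]
  simp only [RCLike.ofReal_real_eq_id, id_eq]
  module

/-- A reflection in a plane reverses orientation, hence anticommutes with the cross product. -/
theorem cross_reflection (q a b : E3) (hq : q ≠ 0) :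
    cross ((ℝ ∙ q)ᗮ.reflection a) ((ℝ ∙ q)ᗮ.reflection b) =
      -(ℝ ∙ q)ᗮ.reflection (cross a b) := by
  have hn : ‖q‖ ^ 2 = q 0 ^ 2 + q 1 ^ 2 + q 2 ^ 2 := by
    simp [EuclideanSpace.real_norm_sq_eq, Fin.sum_univ_three]
  have hpos : q 0 ^ 2 + q 1 ^ 2 + q 2 ^ 2 ≠ 0 := by
    rw [← hn]
    positivity
  simp only [reflection_orthogonal_singleton_apply, hn]
  ext i
  fin_cases i <;> simp [cross, PiLp.inner_apply, Fin.sum_univ_three] <;> field_simp <;> ring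

theorem inv3_eq_inversion (c : E3) (r : ℝ) : inv3 c r = EuclideanGeometry.inversion c r := by
  ext1 p
  simp [inv3, EuclideanGeometry.inversion, dist_eq_norm, div_pow, add_comm]

theorem deriv_inv3_comp (c : E3) (r : ℝ) {f : ℝ → E3} {t : ℝ}
    (hf : DifferentiableAt ℝ f t) (hc : f t ≠ c) :
    deriv (fun s => inv3 c r (f s)) t =
      (r / dist (f t) c) ^ 2 • (ℝ ∙ (f t - c))ᗮ.reflection (deriv f t) := by
  rw [inv3_eq_inversion]
  exact ((EuclideanGeometry.hasFDerivAt_inversion hc).comp_hasDerivAt t hf.hasDerivAt).deriv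

theorem inverse_patch_unit_normal
    (c : E3) (r : ℝ) (hr : 0 < r)
    (x : ℝ → ℝ → E3)
    (hx : ContDiff ℝ (⊤ : ℕ∞) (fun p : ℝ × ℝ => x p.1 p.2))
    (hxc : ∀ u v : ℝ, x u v ≠ c)
    (y : ℝ → ℝ → E3) (hy : ∀ u v : ℝ, y u v = inv3 c r (x u v))
    (hreg : ∀ u v : ℝ, cross (pu x u v) (pv x u v) ≠ 0) :
    ∀ u v : ℝ,
      unormal y u v =
        -unormal x u v + (2 * eta c x u v / ‖x u v - c‖ ^ 2) • (x u v - c) := by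
  intro u v
  have hd : Differentiable ℝ (fun p : ℝ × ℝ => x p.1 p.2) := hx.differentiable (by simp)
  have hdu : DifferentiableAt ℝ (fun t => x t v) u :=
    (hd (u, v)).comp u (f := fun t => (t, v)) (by fun_prop)
  have hdv : DifferentiableAt ℝ (fun t => x u t) v :=
    (hd (u, v)).comp v (f := fun t => (u, t)) (by fun_prop)
  have hq : x u v - c ≠ 0 := sub_ne_zero.mpr (hxc u v)
  have hs : 0 < (r / dist (x u v) c) ^ 2 := by
    have := dist_pos.mpr (hxc u v)
    positivity
  have hyu : pu y u v =
      (r / dist (x u v) c) ^ 2 • (ℝ ∙ (x u v - c))ᗮ.reflection (pu x u v) := by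
    simp only [pu, hy]
    exact deriv_inv3_comp c r hdu (hxc u v)
  have hyv : pv y u v =
      (r / dist (x u v) c) ^ 2 • (ℝ ∙ (x u v - c))ᗮ.reflection (pv x u v) := by
    simp only [pv, hy]
    exact deriv_inv3_comp c r hdv (hxc u v)
  have hU : unormal y u v = -(ℝ ∙ (x u v - c))ᗮ.reflection (unormal x u v) := by
    simp only [unormal, hyu, hyv, cross_smul_smul, cross_reflection _ _ _ hq]
    generalize (r / dist (x u v) c) ^ 2 = s at hs
    rw [norm_smul, norm_neg, LinearIsometryEquiv.norm_map, Real.norm_of_nonneg (by positivity),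
      mul_inv_rev, smul_smul, mul_assoc, inv_mul_cancel₀ (by positivity), mul_one, smul_neg,
      map_smul]
  rw [hU, reflection_orthogonal_singleton_apply, eta, real_inner_comm]
  abel
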